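/- arXiv:1308.6607 — 2 statements merged into one kernel-verified Lean document; each statement's English description precedes it below -/
import Mathlib

section
/- Let H₁, H₂, H₃ ∈ (1/2, 1) with H₁ + H₂ + H₃ > 2, set κ̄ = H₁ + H₂ + H₃ − 2, let T > 0, let f(z) = |z₁|^{2H₁−2}|z₂|^{2H₂−2}|z₃|^{2H₃−2}, and let 0 < ρ₂ < min(2H₁−1, 2H₂−1, 2H₃−1, 2κ̄). Then there exists a constant C > 0 such that for all 0 < h ≤ 1, ∫₀^T ∫_{S²} ∫_{S²} |f(s(ξ+η) + h(ξ+η)) − f(s(ξ+η) + hξ) − f(s(ξ+η) + hη) + f(s(ξ+η))| s² σ(dξ) σ(dη) ds ≤ C h^{ρ₂}. -/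
open MeasureTheory Real
open scoped ENNReal

noncomputable section

abbrev E3 : Type := EuclideanSpace ℝ (Fin 3)

/-- The fractional covariance kernel `f(z) = |z₁|^{2H₁-2} |z₂|^{2H₂-2} |z₃|^{2H₃-2}`. -/
def fracKernel (H₁ H₂ H₃ : ℝ) (z : E3) : ℝ :=
  |z 0| ^ (2 * H₁ - 2) * |z 1| ^ (2 * H₂ - 2) * |z 2| ^ (2 * H₃ - 2)

/-- Uniform surface measure on the unit sphere `S²` in `ℝ³` (total mass `4 π`),
viewed as a measure on `ℝ³`. -/
def sphereMeasure : Measure E3 :=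
  Measure.map (fun x : Metric.sphere (0 : E3) 1 => (x : E3)) ((volume : Measure E3).toSphere)


/-- The area of a planar annulus, described by bounds on the squared norm. -/
lemma volume_annulus_le (A B : ℝ) (hAB : A ≤ B) :
    volume {y : EuclideanSpace ℝ (Fin 2) | A ≤ ‖y‖ ^ 2 ∧ ‖y‖ ^ 2 ≤ B} ≤
      ENNReal.ofReal (π * (B - A)) := by
  rcases lt_or_ge B 0 with hB | hB
  · have : {y : EuclideanSpace ℝ (Fin 2) | A ≤ ‖y‖ ^ 2 ∧ ‖y‖ ^ 2 ≤ B} = ∅ := by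
      ext y
      simp only [Set.mem_ofPred_eq, Set.mem_empty_iff_false, iff_false, not_and, not_le]
      intro _
      exact hB.trans_le (sq_nonneg _)
    simp [this]
  have hA : 0 ≤ max A 0 := le_max_right _ _
  have hsub : {y : EuclideanSpace ℝ (Fin 2) | A ≤ ‖y‖ ^ 2 ∧ ‖y‖ ^ 2 ≤ B} ⊆
      Metric.closedBall 0 (√B) \ Metric.ball 0 (√(max A 0)) := by
    rintro y ⟨h1, h2⟩
    refine ⟨?_, ?_⟩
    · simpa using Real.le_sqrt_of_sq_le h2
    · simp only [Metric.mem_ball, dist_zero_right, not_lt]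
      exact Real.sqrt_le_iff.2 ⟨norm_nonneg _, max_le h1 (sq_nonneg _)⟩
  refine (measure_mono hsub).trans ?_
  rw [measure_sdiff (Metric.ball_subset_closedBall.trans (Metric.closedBall_subset_closedBall
    (Real.sqrt_le_sqrt (max_le hAB hB)))) measurableSet_ball.nullMeasurableSet
    measure_ball_lt_top.ne, EuclideanSpace.volume_closedBall_fin_two,
    EuclideanSpace.volume_ball_fin_two, ← ENNReal.ofReal_pow (Real.sqrt_nonneg _),
    ← ENNReal.ofReal_pow (Real.sqrt_nonneg _), Real.sq_sqrt hB, Real.sq_sqrt hA]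
  rw [← ENNReal.ofReal_mul hB, ← ENNReal.ofReal_mul hA,
    ← ENNReal.ofReal_sub _ (by positivity)]
  apply ENNReal.ofReal_le_ofReal
  nlinarith [Real.pi_pos, le_max_left A 0]

/-- The volume of the part of a spherical shell between two parallel planes. -/
lemma volume_slab_shell_le (α β A B : ℝ) (hAB : A ≤ B) :
    volume {x : E3 | x 0 ∈ Set.Icc α β ∧ A ≤ ‖x‖ ^ 2 ∧ ‖x‖ ^ 2 ≤ B} ≤
      ENNReal.ofReal (π * (B - A)) * ENNReal.ofReal (β - α) := by
  let S : Set (ℝ × (Fin 2 → ℝ)) := {z | z.1 ∈ Set.Icc α β ∧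
    A ≤ z.1 ^ 2 + (z.2 0 ^ 2 + z.2 1 ^ 2) ∧ z.1 ^ 2 + (z.2 0 ^ 2 + z.2 1 ^ 2) ≤ B}
  have hS : MeasurableSet S := by
    have hc : Continuous fun z : ℝ × (Fin 2 → ℝ) => z.1 ^ 2 + (z.2 0 ^ 2 + z.2 1 ^ 2) := by
      fun_prop
    exact ((isClosed_Icc.preimage continuous_fst).inter
      ((isClosed_le continuous_const hc).inter (isClosed_le hc continuous_const))).measurableSet
  have hmp := (volume_preserving_piFinSuccAbove (fun _ : Fin 3 => ℝ) 0).comp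
    (EuclideanSpace.volume_preserving_symm_measurableEquiv_toLp (Fin 3))
  have hpre : {x : E3 | x 0 ∈ Set.Icc α β ∧ A ≤ ‖x‖ ^ 2 ∧ ‖x‖ ^ 2 ≤ B} =
      ((MeasurableEquiv.piFinSuccAbove (fun _ : Fin 3 => ℝ) 0) ∘
        (MeasurableEquiv.toLp 2 (Fin 3 → ℝ)).symm) ⁻¹' S := by
    ext x
    simp [S, EuclideanSpace.real_norm_sq_eq, Fin.sum_univ_three, add_assoc, Fin.tail,
      MeasurableEquiv.piFinSuccAbove]
  rw [hpre, hmp.measure_preimage hS.nullMeasurableSet, Measure.volume_eq_prod,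
    Measure.prod_apply hS]
  have hslice : ∀ t : ℝ, volume (Prod.mk t ⁻¹' S) ≤
      (Set.Icc α β).indicator (fun _ => ENNReal.ofReal (π * (B - A))) t := by
    intro t
    by_cases ht : t ∈ Set.Icc α β
    · rw [Set.indicator_of_mem ht]
      rw [← (EuclideanSpace.volume_preserving_symm_measurableEquiv_toLp (Fin 2)).measure_preimage
        (measurable_prodMk_left hS).nullMeasurableSet]
      refine le_trans (measure_mono ?_) ((volume_annulus_le (A - t ^ 2) (B - t ^ 2)
        (by linarith)).trans (by rw [sub_sub_sub_cancel_right]))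
      rintro y ⟨-, h1, h2⟩
      simp only [Set.mem_ofPred_eq, EuclideanSpace.real_norm_sq_eq, Fin.sum_univ_two]
      simp at h1 h2
      constructor <;> linarith
    · have : Prod.mk t ⁻¹' S = ∅ := by
        ext y
        simp only [S, Set.mem_preimage, Set.mem_ofPred_eq, ht, false_and, Set.mem_empty_iff_false]
      simp [this]
  calc _ ≤ ∫⁻ t, (Set.Icc α β).indicator (fun _ => ENNReal.ofReal (π * (B - A))) t :=
        lintegral_mono hslice
    _ = _ := by
        rw [lintegral_indicator measurableSet_Icc, setLIntegral_const, Real.volume_Icc]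

/-- The volume of the intersection of two spherical shells whose centers are `0` and `w`. -/
lemma volume_shell_inter_shell_le (w : E3) (hw : w ≠ 0) (p q ε : ℝ) (hp : 0 < p) (hq : 0 < q)
    (hε : 0 < ε) :
    volume {x : E3 | ‖x‖ ∈ Set.Icc p (p + ε) ∧ ‖w - x‖ ∈ Set.Icc q (q + ε)} ≤
      ENNReal.ofReal (π * (ε * (2 * p + ε)) * (ε * (p + q + ε) / ‖w‖)) := by
  have hwn : 0 < ‖w‖ := norm_pos_iff.2 hw
  let e : E3 := ‖w‖ • EuclideanSpace.single 0 1
  have he : ‖w‖ = ‖e‖ := by simp [e, norm_smul]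
  let L := (Submodule.span ℝ {w - e})ᗮ.reflection
  have hL : L w = e := Submodule.reflection_sub he
  set α := (‖w‖ ^ 2 + p ^ 2 - (q + ε) ^ 2) / 2 / ‖w‖
  set β := (‖w‖ ^ 2 + (p + ε) ^ 2 - q ^ 2) / 2 / ‖w‖
  have hsub : {x : E3 | ‖x‖ ∈ Set.Icc p (p + ε) ∧ ‖w - x‖ ∈ Set.Icc q (q + ε)} ⊆
      L ⁻¹' {x : E3 | x 0 ∈ Set.Icc α β ∧ p ^ 2 ≤ ‖x‖ ^ 2 ∧ ‖x‖ ^ 2 ≤ (p + ε) ^ 2} := by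
    rintro x ⟨⟨h1, h2⟩, h3, h4⟩
    have hin : inner ℝ w x = ‖w‖ * L x 0 := by
      rw [← L.inner_map_map, hL]
      simp [e, inner_smul_left, EuclideanSpace.inner_single_left]
    have hsq := norm_sub_sq_real w x
    rw [hin] at hsq
    have h1' : p ^ 2 ≤ ‖x‖ ^ 2 := by gcongr
    have h2' : ‖x‖ ^ 2 ≤ (p + ε) ^ 2 := by gcongr
    have h3' : q ^ 2 ≤ ‖w - x‖ ^ 2 := by gcongr
    have h4' : ‖w - x‖ ^ 2 ≤ (q + ε) ^ 2 := by gcongr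
    simp only [Set.mem_preimage, Set.mem_ofPred_eq, LinearIsometryEquiv.norm_map]
    refine ⟨⟨?_, ?_⟩, h1', h2'⟩
    · rw [div_le_iff₀ hwn]; linarith
    · rw [le_div_iff₀ hwn]; linarith
  refine (measure_mono hsub).trans ?_
  have hn : Continuous fun x : E3 => ‖x‖ ^ 2 := by fun_prop
  have hc : IsClosed {x : E3 | x 0 ∈ Set.Icc α β ∧ p ^ 2 ≤ ‖x‖ ^ 2 ∧ ‖x‖ ^ 2 ≤ (p + ε) ^ 2} :=
    (isClosed_Icc.preimage (by fun_prop)).inter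
      ((isClosed_le continuous_const hn).inter (isClosed_le hn continuous_const))
  rw [L.measurePreserving.measure_preimage hc.measurableSet.nullMeasurableSet]
  refine (volume_slab_shell_le α β (p ^ 2) ((p + ε) ^ 2) (by nlinarith)).trans ?_
  rw [← ENNReal.ofReal_mul (mul_nonneg Real.pi_pos.le (by nlinarith))]
  apply ENNReal.ofReal_le_ofReal
  apply le_of_eq
  simp only [α, β]
  field_simp
  ring

/-- Integration in polar coordinates on `ℝ³`. -/
lemma lintegral_eq_lintegral_sphere (g : E3 → ℝ≥0∞) (hg : Measurable g) :
    ∫⁻ x, g x = ∫⁻ ξ : Metric.sphere (0 : E3) 1,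
      (∫⁻ r in Set.Ioi (0 : ℝ), ENNReal.ofReal (r ^ 2) * g (r • (ξ : E3)))
        ∂(volume : Measure E3).toSphere := by
  have h1 : ∫⁻ x, g x = ∫⁻ x : ({(0 : E3)}ᶜ : Set E3), g x ∂((volume : Measure E3).comap (↑)) := by
    rw [lintegral_subtype_comap (measurableSet_singleton _).compl g,
      restrict_compl_singleton]
  have hmp := (volume : Measure E3).measurePreserving_homeomorphUnitSphereProd
  have hm : Measurable fun z : Metric.sphere (0 : E3) 1 × Set.Ioi (0 : ℝ) =>
      g ((z.2 : ℝ) • (z.1 : E3)) := hg.comp (by fun_prop)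
  have h2 : ∫⁻ x : ({(0 : E3)}ᶜ : Set E3), g x ∂((volume : Measure E3).comap (↑)) =
      ∫⁻ z, g ((z.2 : ℝ) • (z.1 : E3)) ∂((volume : Measure E3).toSphere.prod
        (Measure.volumeIoiPow (Module.finrank ℝ E3 - 1))) := by
    rw [← hmp.lintegral_comp hm]
    refine lintegral_congr fun x => ?_
    have hx : ‖(x : E3)‖ ≠ 0 := norm_ne_zero_iff.2 x.2
    simp [smul_smul, hx]
  rw [h1, h2, lintegral_prod _ hm.aemeasurable]
  refine lintegral_congr fun ξ => ?_
  have hm' : Measurable fun r : ℝ => g (r • (ξ : E3)) := hg.comp (by fun_prop)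
  rw [Measure.volumeIoiPow]
  refine (lintegral_withDensity_eq_lintegral_mul _ (by fun_prop)
    (hm'.comp measurable_subtype_coe)).trans ?_
  simp only [finrank_euclideanSpace, Fintype.card_fin, Pi.mul_apply, Function.comp_apply]
  exact lintegral_subtype_comap measurableSet_Ioi
    (fun r : ℝ => ENNReal.ofReal (r ^ 2) * g (r • (ξ : E3)))

/-- A spherical shell. -/
def shell (p ε : ℝ) : Set E3 := {x | ‖x‖ ∈ Set.Icc p (p + ε)}

lemma measurableSet_shell (p ε : ℝ) : MeasurableSet (shell p ε) :=
  (isClosed_Icc.preimage continuous_norm).measurableSet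

lemma lintegral_sphere_le_lintegral_shell (g : E3 → ℝ≥0∞) (hg : Measurable g) (p ε : ℝ)
    (hp : 0 < p) :
    ENNReal.ofReal (p ^ 2) * ∫⁻ r in Set.Icc p (p + ε),
      ∫⁻ ξ : Metric.sphere (0 : E3) 1, g (r • (ξ : E3)) ∂(volume : Measure E3).toSphere ≤
    ∫⁻ x in shell p ε, g x := by
  have hm : Measurable fun z : ℝ × Metric.sphere (0 : E3) 1 => g (z.1 • (z.2 : E3)) :=
    hg.comp (by fun_prop)
  rw [← lintegral_indicator (measurableSet_shell p ε),
    lintegral_eq_lintegral_sphere _ (hg.indicator (measurableSet_shell p ε)),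
    lintegral_lintegral_swap hm.aemeasurable,
    ← lintegral_const_mul' _ _ ENNReal.ofReal_ne_top]
  refine lintegral_mono fun ξ => ?_
  rw [← lintegral_const_mul' _ _ ENNReal.ofReal_ne_top,
    ← lintegral_indicator measurableSet_Icc, ← lintegral_indicator measurableSet_Ioi]
  refine lintegral_mono fun r => ?_
  by_cases hr : r ∈ Set.Icc p (p + ε)
  · have hr0 : 0 < r := hp.trans_le hr.1
    have hs : r • (ξ : E3) ∈ shell p ε := by
      simpa [shell, norm_smul, abs_of_pos hr0] using hr
    rw [Set.indicator_of_mem hr, Set.indicator_of_mem (show r ∈ Set.Ioi 0 from hr0),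
      Set.indicator_of_mem hs]
    gcongr
    exact hr.1
  · simp [Set.indicator_of_notMem hr]

lemma mul_le_lintegral_shell_shell (g : E3 → ℝ≥0∞) (hg : Measurable g) (p q ε : ℝ)
    (hp : 0 < p) (hq : 0 < q) (K : ℝ≥0∞)
    (hK : ∀ r ∈ Set.Icc p (p + ε), ∀ t ∈ Set.Icc q (q + ε),
      K ≤ ∫⁻ ξ : Metric.sphere (0 : E3) 1, ∫⁻ η : Metric.sphere (0 : E3) 1,
        g (r • (ξ : E3) + t • (η : E3)) ∂(volume : Measure E3).toSphere
          ∂(volume : Measure E3).toSphere) :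
    ENNReal.ofReal (p ^ 2) * (ENNReal.ofReal (q ^ 2) *
      (K * ENNReal.ofReal ε * ENNReal.ofReal ε)) ≤
      ∫⁻ x in shell p ε, ∫⁻ y in shell q ε, g (x + y) := by
  have hm : Measurable fun z : E3 × E3 => g (z.1 + z.2) := hg.comp (by fun_prop)
  refine le_trans ?_ (lintegral_sphere_le_lintegral_shell _ hm.lintegral_prod_right' p ε hp)
  gcongr
  have step : ∀ r ∈ Set.Icc p (p + ε), ENNReal.ofReal (q ^ 2) * (K * ENNReal.ofReal ε) ≤
      ∫⁻ ξ : Metric.sphere (0 : E3) 1, (∫⁻ y in shell q ε, g (r • (ξ : E3) + y))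
        ∂(volume : Measure E3).toSphere := by
    intro r hr
    have hm2 : Measurable fun z : Metric.sphere (0 : E3) 1 × (ℝ × Metric.sphere (0 : E3) 1) =>
      g (r • (z.1 : E3) + z.2.1 • (z.2.2 : E3)) := hg.comp (by fun_prop)
    calc ENNReal.ofReal (q ^ 2) * (K * ENNReal.ofReal ε)
        = ENNReal.ofReal (q ^ 2) * ∫⁻ _ in Set.Icc q (q + ε), K := by
          rw [setLIntegral_const, Real.volume_Icc, add_sub_cancel_left]
      _ ≤ ENNReal.ofReal (q ^ 2) * ∫⁻ t in Set.Icc q (q + ε), ∫⁻ ξ : Metric.sphere (0 : E3) 1,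
          ∫⁻ η : Metric.sphere (0 : E3) 1, g (r • (ξ : E3) + t • (η : E3))
            ∂(volume : Measure E3).toSphere ∂(volume : Measure E3).toSphere := by
          refine mul_le_mul_right ?_ _
          exact setLIntegral_mono' measurableSet_Icc fun t ht => hK r hr t ht
      _ = ∫⁻ ξ : Metric.sphere (0 : E3) 1, (ENNReal.ofReal (q ^ 2) * ∫⁻ t in Set.Icc q (q + ε),
          ∫⁻ η : Metric.sphere (0 : E3) 1, g (r • (ξ : E3) + t • (η : E3))
            ∂(volume : Measure E3).toSphere) ∂(volume : Measure E3).toSphere := by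
          rw [lintegral_const_mul' _ _ ENNReal.ofReal_ne_top, lintegral_lintegral_swap]
          refine Measurable.aemeasurable ?_
          exact Measurable.lintegral_prod_right'
            (f := fun z : (ℝ × Metric.sphere (0 : E3) 1) × Metric.sphere (0 : E3) 1 =>
              g (r • (z.1.2 : E3) + z.1.1 • (z.2 : E3))) (hg.comp (by fun_prop))
      _ ≤ _ := by
          refine lintegral_mono fun ξ => ?_
          exact lintegral_sphere_le_lintegral_shell (fun y => g (r • (ξ : E3) + y))
            (hg.comp (by fun_prop)) q ε hq
  calc ENNReal.ofReal (q ^ 2) * (K * ENNReal.ofReal ε * ENNReal.ofReal ε)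
      = ∫⁻ _ in Set.Icc p (p + ε), ENNReal.ofReal (q ^ 2) * (K * ENNReal.ofReal ε) := by
        rw [setLIntegral_const, Real.volume_Icc, add_sub_cancel_left]; ring
    _ ≤ _ := setLIntegral_mono' measurableSet_Icc step

lemma lintegral_shell_shell_le (g : E3 → ℝ≥0∞) (hg : Measurable g) (p q ε : ℝ)
    (hp : 0 < p) (hq : 0 < q) (hε : 0 < ε) :
    ∫⁻ x in shell p ε, ∫⁻ y in shell q ε, g (x + y) ≤
      ENNReal.ofReal (π * (ε * (2 * p + ε)) * (ε * (p + q + ε))) *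
        ∫⁻ w in Metric.closedBall (0 : E3) (p + q + 2 * ε), g w * ENNReal.ofReal ‖w‖⁻¹ := by
  have hsp := measurableSet_shell p ε
  have hsq := measurableSet_shell q ε
  calc ∫⁻ x in shell p ε, ∫⁻ y in shell q ε, g (x + y)
      = ∫⁻ x in shell p ε, ∫⁻ w, (shell q ε).indicator 1 (w - x) * g w := by
        refine lintegral_congr fun x => ?_
        rw [← lintegral_indicator hsq,
          ← lintegral_sub_right_eq_self ((shell q ε).indicator fun y => g (x + y)) x]
        refine lintegral_congr fun w => ?_
        by_cases hw : w - x ∈ shell q ε <;> simp [hw]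
    _ = ∫⁻ w, ∫⁻ x in shell p ε, (shell q ε).indicator 1 (w - x) * g w := by
        refine lintegral_lintegral_swap (Measurable.aemeasurable ?_)
        refine Measurable.mul ?_ (hg.comp measurable_snd)
        exact (measurable_one.indicator hsq).comp (measurable_snd.sub measurable_fst)
    _ ≤ ∫⁻ w, (Metric.closedBall (0 : E3) (p + q + 2 * ε)).indicator (fun w =>
          ENNReal.ofReal (π * (ε * (2 * p + ε)) * (ε * (p + q + ε))) *
            (g w * ENNReal.ofReal ‖w‖⁻¹)) w := by
        refine lintegral_mono_ae ?_
        filter_upwards [compl_mem_ae_iff.2 (measure_singleton (0 : E3))] with w hw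
        have hmi : Measurable fun x => (shell q ε).indicator (1 : E3 → ℝ≥0∞) (w - x) :=
          (measurable_one.indicator hsq).comp (measurable_const.sub measurable_id)
        rw [lintegral_mul_const _ hmi]
        have hint : ∫⁻ x in shell p ε, (shell q ε).indicator 1 (w - x) =
            volume {x : E3 | ‖x‖ ∈ Set.Icc p (p + ε) ∧ ‖w - x‖ ∈ Set.Icc q (q + ε)} := by
          have hms : MeasurableSet ((fun x => w - x) ⁻¹' shell q ε) :=
            (measurable_const.sub measurable_id) hsq
          have : (fun x => (shell q ε).indicator (1 : E3 → ℝ≥0∞) (w - x)) =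
            ((fun x => w - x) ⁻¹' shell q ε).indicator 1 := by
            ext x; rfl
          rw [this, lintegral_indicator_one hms, Measure.restrict_apply hms, Set.inter_comm]
          rfl
        rw [hint]
        by_cases hwR : w ∈ Metric.closedBall (0 : E3) (p + q + 2 * ε)
        · rw [Set.indicator_of_mem hwR]
          calc _ ≤ ENNReal.ofReal (π * (ε * (2 * p + ε)) * (ε * (p + q + ε) / ‖w‖)) * g w := by
                gcongr
                exact volume_shell_inter_shell_le w hw p q ε hp hq hε
            _ = _ := by
                rw [div_eq_mul_inv, ← mul_assoc, ENNReal.ofReal_mul (by positivity)]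
                ring
        · have : {x : E3 | ‖x‖ ∈ Set.Icc p (p + ε) ∧ ‖w - x‖ ∈ Set.Icc q (q + ε)} = ∅ := by
            ext x
            simp only [Set.mem_ofPred_eq, Set.mem_empty_iff_false, iff_false]
            rintro ⟨⟨-, h1⟩, -, h2⟩
            apply hwR
            rw [mem_closedBall_zero_iff]
            have := norm_add_le x (w - x)
            rw [add_sub_cancel] at this
            linarith
          rw [this, measure_empty, zero_mul]
          exact zero_le
    _ = _ := by
        rw [lintegral_indicator Metric.isClosed_closedBall.measurableSet,
          lintegral_const_mul' _ _ ENNReal.ofReal_ne_top]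

/-- The product of powers `∏ i, |zᵢ| ^ (-bᵢ)`, infinite on the coordinate planes. -/
def powKernel (b : Fin 3 → ℝ) (z : E3) : ℝ≥0∞ :=
  ∏ i, ‖z i‖ₑ ^ (-b i)

lemma continuous_powKernel {b : Fin 3 → ℝ} (hb : ∀ i, 0 < b i) : Continuous (powKernel b) := by
  have hc (i : Fin 3) : Continuous fun z : E3 => ‖z i‖ₑ ^ (-b i) :=
    ENNReal.continuous_rpow_const.comp (continuous_enorm.comp (by fun_prop))
  have hne (i : Fin 3) (z : E3) : ‖z i‖ₑ ^ (-b i) ≠ 0 := by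
    simp [ENNReal.rpow_eq_zero_iff, not_lt.2 (hb i).le]
  have heq : powKernel b =
      fun z => ‖z 0‖ₑ ^ (-b 0) * ‖z 1‖ₑ ^ (-b 1) * ‖z 2‖ₑ ^ (-b 2) := by
    ext z
    rw [powKernel, Fin.prod_univ_three]
  rw [heq, continuous_iff_continuousAt]
  intro z
  have h01 := ENNReal.Tendsto.mul (hc 0).continuousAt.tendsto (Or.inl (hne 0 z))
    (hc 1).continuousAt.tendsto (Or.inl (hne 1 z))
  exact ENNReal.Tendsto.mul h01 (Or.inl (mul_ne_zero (hne 0 z) (hne 1 z)))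
    (hc 2).continuousAt.tendsto (Or.inl (hne 2 z))

lemma powKernel_eq_ofReal {b : Fin 3 → ℝ} {z : E3} (hz : ∀ i, z i ≠ 0) :
    powKernel b z = ENNReal.ofReal (∏ i, |z i| ^ (-b i)) := by
  rw [powKernel, ENNReal.ofReal_prod_of_nonneg fun i _ => by positivity]
  refine Finset.prod_congr rfl fun i _ => ?_
  rw [Real.enorm_eq_ofReal_abs, ENNReal.ofReal_rpow_of_pos (abs_pos.2 (hz i))]

lemma powKernel_eq_top {b : Fin 3 → ℝ} (hb : ∀ i, 0 < b i) {z : E3} {j : Fin 3} (hz : z j = 0) :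
    powKernel b z = ⊤ := by
  rw [powKernel, ← Finset.mul_prod_erase _ _ (Finset.mem_univ j), hz, enorm_zero,
    ENNReal.zero_rpow_of_neg (neg_lt_zero.2 (hb j))]
  refine ENNReal.top_mul (Finset.prod_ne_zero_iff.2 fun i _ => ?_)
  simp [ENNReal.rpow_eq_zero_iff, not_lt.2 (hb i).le]

lemma integrable_indicator_abs_rpow {c : ℝ} (hc : c < 1) (R : ℝ) :
    Integrable ((Set.Icc (-R) R).indicator fun x : ℝ => |x| ^ (-c)) := by
  rw [integrable_indicator_iff measurableSet_Icc]
  rcases lt_or_ge R 0 with hR | hR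
  · rw [Set.Icc_eq_empty (by linarith)]; exact integrableOn_empty
  have hpos : IntegrableOn (fun x : ℝ => |x| ^ (-c)) (Set.Icc 0 R) := by
    have := (intervalIntegral.intervalIntegrable_rpow' (a := 0) (b := R) (r := -c) (by linarith))
    rw [intervalIntegrable_iff_integrableOn_Icc_of_le hR] at this
    refine this.congr_fun (fun x hx => ?_) measurableSet_Icc
    simp only [abs_of_nonneg hx.1]
  have hneg : IntegrableOn (fun x : ℝ => |x| ^ (-c)) (Set.Icc (-R) 0) := by
    have := (Measure.measurePreserving_neg (volume : Measure ℝ)).integrableOn_comp_preimage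
      (Homeomorph.neg ℝ).measurableEmbedding (f := fun x : ℝ => |x| ^ (-c)) (s := Set.Icc 0 R)
    have h2 := this.2 hpos
    simpa [Function.comp_def] using h2
  rw [← Set.Icc_union_Icc_eq_Icc (b := 0) (by linarith) hR]
  exact hneg.union hpos

lemma prod_abs_rpow_le_norm (θ : Fin 3 → ℝ) (hθ : ∀ i, 0 ≤ θ i) (hsum : ∑ i, θ i = 1) (w : E3) :
    ∏ i, |w i| ^ θ i ≤ ‖w‖ := by
  calc ∏ i, |w i| ^ θ i ≤ ∏ i, ‖w‖ ^ θ i := by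
        refine Finset.prod_le_prod (fun i _ => by positivity) fun i _ => ?_
        exact Real.rpow_le_rpow (abs_nonneg _) (PiLp.norm_apply_le w i) (hθ i)
    _ = ‖w‖ := by
        rw [← Real.rpow_sum_of_nonneg (norm_nonneg _) (fun i _ => hθ i), hsum, Real.rpow_one]

lemma lintegral_powKernel_mul_inv_norm_lt_top {b : Fin 3 → ℝ} (hb1 : ∀ i, b i < 1)
    (hsum : ∑ i, b i < 2) (R : ℝ) :
    ∫⁻ w in Metric.closedBall (0 : E3) R, powKernel b w * ENNReal.ofReal ‖w‖⁻¹ < ⊤ := by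
  set S := ∑ i, (1 - b i) with hS
  have hS1 : 1 < S := by
    simp only [hS, Fin.sum_univ_three] at *
    linarith
  let θ : Fin 3 → ℝ := fun i => (1 - b i) / S
  have hθ0 (i) : 0 ≤ θ i := div_nonneg (by linarith [hb1 i]) (by linarith)
  have hθsum : ∑ i, θ i = 1 := by
    rw [← Finset.sum_div, ← hS, div_self (by linarith)]
  have hc (i) : b i + θ i < 1 := by
    have : θ i < 1 - b i := div_lt_self (by linarith [hb1 i]) hS1
    linarith
  let g : Fin 3 → ℝ → ℝ := fun i => (Set.Icc (-R) R).indicator fun x => |x| ^ (-(b i + θ i))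
  have hg : Integrable (fun x : Fin 3 → ℝ => ∏ i, g i (x i)) :=
    Integrable.fintype_prod fun i => integrable_indicator_abs_rpow (hc i) R
  have hmp := EuclideanSpace.volume_preserving_symm_measurableEquiv_toLp (Fin 3)
  have hgE : Integrable (fun w : E3 => ∏ i, g i (w i)) :=
    hmp.integrable_comp_of_integrable hg
  have hae : ∀ᵐ w : E3, ∀ i, w i ≠ 0 := by
    rw [ae_all_iff]
    intro i
    have h0 : ∀ᵐ x : Fin 3 → ℝ, x i ≠ 0 := by
      rw [ae_iff]
      simp only [ne_eq, not_not]
      exact Measure.pi_hyperplane (fun _ : Fin 3 => (volume : Measure ℝ)) i 0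
    exact hmp.quasiMeasurePreserving.ae h0
  rw [← lintegral_indicator Metric.isClosed_closedBall.measurableSet]
  refine lt_of_le_of_lt (lintegral_mono_ae ?_) hgE.lintegral_lt_top
  filter_upwards [hae] with w hw
  by_cases hwR : w ∈ Metric.closedBall (0 : E3) R
  · rw [Set.indicator_of_mem hwR, powKernel_eq_ofReal hw, ← ENNReal.ofReal_mul (by positivity)]
    refine ENNReal.ofReal_le_ofReal ?_
    have hpos : 0 < ∏ i, |w i| ^ θ i :=
      Finset.prod_pos fun i _ => Real.rpow_pos_of_pos (abs_pos.2 (hw i)) _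
    calc (∏ i, |w i| ^ (-b i)) * ‖w‖⁻¹
        ≤ (∏ i, |w i| ^ (-b i)) * (∏ i, |w i| ^ θ i)⁻¹ := by
          gcongr
          exact prod_abs_rpow_le_norm θ hθ0 hθsum w
      _ = ∏ i, g i (w i) := by
          rw [← Finset.prod_inv_distrib, ← Finset.prod_mul_distrib]
          refine Finset.prod_congr rfl fun i _ => ?_
          have hi : w i ∈ Set.Icc (-R) R := by
            refine abs_le.1 ?_
            exact (PiLp.norm_apply_le w i).trans (mem_closedBall_zero_iff.1 hwR)
          simp only [g, Set.indicator_of_mem hi]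
          rw [← Real.rpow_neg (abs_nonneg _), ← Real.rpow_add (abs_pos.2 (hw i)), neg_add]
  · simp [Set.indicator_of_notMem hwR]

/-- The integral of `powKernel b (p ξ + q η)` over pairs of points of the unit sphere. -/
def sphereInt (b : Fin 3 → ℝ) (p q : ℝ) : ℝ≥0∞ :=
  ∫⁻ ξ : Metric.sphere (0 : E3) 1, ∫⁻ η : Metric.sphere (0 : E3) 1,
    powKernel b (p • (ξ : E3) + q • (η : E3)) ∂(volume : Measure E3).toSphere
      ∂(volume : Measure E3).toSphere

lemma eventually_lt_sphereInt {b : Fin 3 → ℝ} (hb : ∀ i, 0 < b i) (p q : ℝ) {K : ℝ≥0∞}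
    (hK : K < sphereInt b p q) : ∀ᶠ z in nhds (p, q), K < sphereInt b z.1 z.2 := by
  have hc := continuous_powKernel hb
  have hprod (p q : ℝ) : sphereInt b p q =
      ∫⁻ z : Metric.sphere (0 : E3) 1 × Metric.sphere (0 : E3) 1,
        powKernel b (p • (z.1 : E3) + q • (z.2 : E3))
        ∂((volume : Measure E3).toSphere.prod (volume : Measure E3).toSphere) := by
    rw [lintegral_prod]
    · rfl
    · exact (hc.measurable.comp (by fun_prop)).aemeasurable
  refine Filter.eventually_lt_of_lt_liminf (hK.trans_le ?_)
  simp only [hprod]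
  refine le_trans (lintegral_mono fun z => ?_)
    (lintegral_liminf_le fun _ => hc.measurable.comp (by fun_prop))
  refine le_of_eq (Filter.Tendsto.liminf_eq ?_).symm
  have : Continuous fun i : ℝ × ℝ => powKernel b (i.1 • (z.1 : E3) + i.2 • (z.2 : E3)) :=
    hc.comp (by fun_prop)
  exact this.tendsto (p, q)

/-- Scale invariant bound for the integral of a product of powers over pairs of spheres. -/
lemma exists_sphereInt_mul_sq_le {b : Fin 3 → ℝ} (hb : ∀ i, 0 < b i) (hb1 : ∀ i, b i < 1)
    (hsum : ∑ i, b i < 2) (R : ℝ) :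
    ∃ D : ℝ≥0∞, D ≠ ⊤ ∧ ∀ s p q : ℝ, 0 < s → s ≤ p → s ≤ q → p ≤ R → q ≤ R →
      sphereInt b p q * ENNReal.ofReal (s ^ 2) ≤ D := by
  set J := ∫⁻ w in Metric.closedBall (0 : E3) (2 * R + 2), powKernel b w * ENNReal.ofReal ‖w‖⁻¹
    with hJ
  have hJtop : J ≠ ⊤ := (lintegral_powKernel_mul_inv_norm_lt_top hb1 hsum _).ne
  refine ⟨ENNReal.ofReal (12 * π) * J, ENNReal.mul_ne_top ENNReal.ofReal_ne_top hJtop, ?_⟩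
  intro s p q hs hp hq hpR hqR
  have hp0 : 0 < p := hs.trans_le hp
  have hq0 : 0 < q := hs.trans_le hq
  have hs2 : ENNReal.ofReal (s ^ 2) ≠ 0 := by
    rw [ne_eq, ENNReal.ofReal_eq_zero, not_le]; positivity
  rw [← ENNReal.le_div_iff_mul_le (Or.inl hs2) (Or.inl ENNReal.ofReal_ne_top)]
  refine le_of_forall_lt_imp_le_of_dense fun K hK => ?_
  rw [ENNReal.le_div_iff_mul_le (Or.inl hs2) (Or.inl ENNReal.ofReal_ne_top)]
  obtain ⟨δ, hδ, hball⟩ := Metric.eventually_nhds_iff.1 (eventually_lt_sphereInt hb p q hK)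
  set ε := min (δ / 2) (min p (min q 1)) with hε
  have hε0 : 0 < ε := by simp only [hε, lt_min_iff]; exact ⟨by linarith, hp0, hq0, one_pos⟩
  have hεδ : ε ≤ δ / 2 := min_le_left _ _
  have hεp : ε ≤ p := (min_le_right _ _).trans (min_le_left _ _)
  have hεq : ε ≤ q := (min_le_right _ _).trans ((min_le_right _ _).trans (min_le_left _ _))
  have hε1 : ε ≤ 1 := (min_le_right _ _).trans ((min_le_right _ _).trans (min_le_right _ _))
  have hm := (continuous_powKernel hb).measurable
  have h1 := mul_le_lintegral_shell_shell (powKernel b) hm p q ε hp0 hq0 K (by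
    rintro r ⟨hr1, hr2⟩ t ⟨ht1, ht2⟩
    refine (@hball (r, t) ?_).le
    rw [Prod.dist_eq, max_lt_iff, Real.dist_eq, Real.dist_eq, abs_lt, abs_lt]
    refine ⟨⟨?_, ?_⟩, ?_, ?_⟩ <;> simp only <;> linarith)
  have h2 : ENNReal.ofReal (p ^ 2) * (ENNReal.ofReal (q ^ 2) *
      (K * ENNReal.ofReal ε * ENNReal.ofReal ε)) ≤
      ENNReal.ofReal (π * (ε * (2 * p + ε)) * (ε * (p + q + ε))) * J := by
    refine (h1.trans (lintegral_shell_shell_le (powKernel b) hm p q ε hp0 hq0 hε0)).trans ?_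
    refine mul_le_mul_right (lintegral_mono_set (Metric.closedBall_subset_closedBall ?_)) _
    linarith
  lift K to NNReal using hK.ne_top
  lift J to NNReal using hJtop with j
  have hπ := Real.pi_pos
  have h3 := ENNReal.toReal_mono (ENNReal.mul_ne_top ENNReal.ofReal_ne_top ENNReal.coe_ne_top) h2
  simp only [ENNReal.toReal_mul, ENNReal.coe_toReal] at h3
  rw [ENNReal.toReal_ofReal (by positivity), ENNReal.toReal_ofReal (by positivity),
    ENNReal.toReal_ofReal (by positivity), ENNReal.toReal_ofReal (by positivity)] at h3
  rw [← ENNReal.ofReal_coe_nnreal, ← ENNReal.ofReal_coe_nnreal (p := j),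
    ← ENNReal.ofReal_mul (by positivity), ← ENNReal.ofReal_mul (by positivity)]
  refine ENNReal.ofReal_le_ofReal ?_
  have hk : (0 : ℝ) ≤ K := K.2
  have hj : (0 : ℝ) ≤ j := j.2
  have h4 : (p * ε ^ 2) * (p * q ^ 2 * K) ≤ (p * ε ^ 2) * (6 * π * (p + q) * j) := by
    calc (p * ε ^ 2) * (p * q ^ 2 * K) = p ^ 2 * (q ^ 2 * (K * ε * ε)) := by ring
      _ ≤ _ := h3
      _ ≤ π * (ε * (2 * p + p)) * (ε * (p + q + (p + q))) * j := by gcongr; linarith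
      _ = _ := by ring
  have h5 := le_of_mul_le_mul_left h4 (by positivity)
  have h6 : s ^ 2 * (p + q) ≤ 2 * (p * q ^ 2) := by
    have e1 : s ^ 2 * p ≤ q ^ 2 * p := by gcongr
    have e2 : s * s * q ≤ p * q * q := by gcongr
    nlinarith
  have h7 : (p + q) * (K * s ^ 2) ≤ (p + q) * (12 * π * j) := by
    calc (p + q) * (K * s ^ 2) = K * (s ^ 2 * (p + q)) := by ring
      _ ≤ K * (2 * (p * q ^ 2)) := by gcongr
      _ ≤ _ := by linarith
  exact le_of_mul_le_mul_left h7 (by positivity)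

/-- Hölder estimate for a product of negative powers, with a singular weight at the two endpoints. -/
lemma exists_abs_prod_rpow_sub_le (a u v : Fin 3 → ℝ) (ρ h : ℝ) (ha0 : ∀ i, 0 ≤ a i)
    (ha1 : ∀ i, a i ≤ 1) (hρ0 : 0 ≤ ρ) (hρ1 : ρ ≤ 1) (hh : 0 < h) (hu : ∀ i, 0 < u i)
    (hv : ∀ i, 0 < v i) (huv : ∀ i, |u i - v i| ≤ h) :
    ∃ j, |∏ i, u i ^ (-a i) - ∏ i, v i ^ (-a i)| ≤
      14 * h ^ ρ * (u j ^ (-ρ) * ∏ i, u i ^ (-a i) + v j ^ (-ρ) * ∏ i, v i ^ (-a i)) := by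
  obtain ⟨j, hj⟩ := Finite.exists_min u
  refine ⟨j, ?_⟩
  set P := ∏ i, u i ^ (-a i) with hP
  set Q := ∏ i, v i ^ (-a i) with hQ
  have hP0 : 0 < P := Finset.prod_pos fun i _ => Real.rpow_pos_of_pos (hu i) _
  have hQ0 : 0 < Q := Finset.prod_pos fun i _ => Real.rpow_pos_of_pos (hv i) _
  have hhρ : 0 < h ^ ρ := Real.rpow_pos_of_pos hh _
  have huρ : 0 < u j ^ (-ρ) := Real.rpow_pos_of_pos (hu j) _
  have hvρ : 0 < v j ^ (-ρ) := Real.rpow_pos_of_pos (hv j) _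
  rcases le_or_gt (u j) (2 * h) with hcase | hcase
  · have key : ∀ x, 0 < x → x ≤ 3 * h → 1 ≤ 14 * h ^ ρ * x ^ (-ρ) := by
      intro x hx hx3
      have h1 : x ^ ρ ≤ (3 * h) ^ ρ := Real.rpow_le_rpow hx.le hx3 hρ0
      rw [Real.mul_rpow (by norm_num) hh.le] at h1
      have h2 : (3 : ℝ) ^ ρ ≤ 3 ^ (1 : ℝ) := Real.rpow_le_rpow_of_exponent_le (by norm_num) hρ1
      rw [Real.rpow_one] at h2
      have hxρ : 0 < x ^ ρ := Real.rpow_pos_of_pos hx _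
      rw [Real.rpow_neg hx.le, ← div_eq_mul_inv, le_div_iff₀ hxρ]
      nlinarith
    have k1 := key (u j) (hu j) (by linarith)
    have k2 := key (v j) (hv j) (by linarith [(abs_le.1 (huv j)).1])
    have : |P - Q| ≤ P + Q := by rw [abs_le]; constructor <;> linarith
    nlinarith
  · set τ := h / u j with hτ
    have hτ0 : 0 < τ := div_pos hh (hu j)
    have hτ1 : τ < 1 / 2 := by rw [hτ, div_lt_iff₀ (hu j)]; linarith
    have hτu (i) : h ≤ τ * u i := by
      rw [hτ, div_mul_eq_mul_div, le_div_iff₀ (hu j)]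
      exact mul_le_mul_of_nonneg_left (hj i) hh.le
    have hfac (i) : (1 - τ) * u i ^ (-a i) ≤ v i ^ (-a i) ∧
        v i ^ (-a i) ≤ (1 + 2 * τ) * u i ^ (-a i) := by
      have hlo : (1 - τ) * u i ≤ v i := by linarith [hτu i, (abs_le.1 (huv i)).2]
      have hhi : v i ≤ (1 + τ) * u i := by linarith [hτu i, (abs_le.1 (huv i)).1]
      have hui := (Real.rpow_pos_of_pos (hu i) (-a i)).le
      constructor
      · calc (1 - τ) * u i ^ (-a i) ≤ (1 + τ) ^ (-a i) * u i ^ (-a i) := by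
              gcongr
              calc 1 - τ ≤ (1 + τ)⁻¹ := by
                    rw [le_inv_comm₀ (by linarith) (by linarith), ← one_div,
                      le_div_iff₀ (by linarith)]; nlinarith
                _ = (1 + τ) ^ (-1 : ℝ) := (Real.rpow_neg_one _).symm
                _ ≤ _ := Real.rpow_le_rpow_of_exponent_le (by linarith) (by linarith [ha1 i])
          _ = ((1 + τ) * u i) ^ (-a i) := (Real.mul_rpow (by linarith) (hu i).le).symm
          _ ≤ _ := Real.rpow_le_rpow_of_nonpos (hv i) hhi (by linarith [ha0 i])
      · have hpos : 0 < 1 - τ := by linarith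
        calc v i ^ (-a i) ≤ ((1 - τ) * u i) ^ (-a i) :=
              Real.rpow_le_rpow_of_nonpos (mul_pos hpos (hu i)) hlo (by linarith [ha0 i])
          _ = (1 - τ) ^ (-a i) * u i ^ (-a i) := Real.mul_rpow hpos.le (hu i).le
          _ ≤ _ := by
              gcongr
              calc (1 - τ) ^ (-a i) ≤ (1 - τ) ^ (-1 : ℝ) :=
                    Real.rpow_le_rpow_of_exponent_ge hpos (by linarith) (by linarith [ha1 i])
                _ = (1 - τ)⁻¹ := Real.rpow_neg_one _
                _ ≤ 1 + 2 * τ := by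
                    rw [← one_div, div_le_iff₀ hpos]; nlinarith
    have hlow : (1 - τ) ^ 3 * P ≤ Q := by
      calc (1 - τ) ^ 3 * P = ∏ i, (1 - τ) * u i ^ (-a i) := by
            rw [Finset.prod_mul_distrib, Finset.prod_const, Finset.card_univ, Fintype.card_fin]
        _ ≤ Q := Finset.prod_le_prod (fun i _ => mul_nonneg (by linarith)
            (Real.rpow_pos_of_pos (hu i) _).le) fun i _ => (hfac i).1
    have hup : Q ≤ (1 + 2 * τ) ^ 3 * P := by
      calc Q ≤ ∏ i, (1 + 2 * τ) * u i ^ (-a i) :=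
            Finset.prod_le_prod (fun i _ => (Real.rpow_pos_of_pos (hv i) _).le)
              fun i _ => (hfac i).2
        _ = _ := by
            rw [Finset.prod_mul_distrib, Finset.prod_const, Finset.card_univ, Fintype.card_fin]
    have e1 : 1 - 14 * τ ≤ (1 - τ) ^ 3 := by nlinarith [mul_pos hτ0 hτ0]
    have e2 : (1 + 2 * τ) ^ 3 ≤ 1 + 14 * τ := by nlinarith [mul_pos hτ0 hτ0]
    have hτρ : τ ≤ h ^ ρ * u j ^ (-ρ) := by
      calc τ = τ ^ (1 : ℝ) := (Real.rpow_one τ).symm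
        _ ≤ τ ^ ρ := Real.rpow_le_rpow_of_exponent_ge hτ0 (by linarith) hρ1
        _ = _ := by
            rw [hτ, Real.div_rpow hh.le (hu j).le, Real.rpow_neg (hu j).le, div_eq_mul_inv]
    have h1 : |P - Q| ≤ 14 * τ * P := by
      rw [abs_le]
      constructor <;> nlinarith
    calc |P - Q| ≤ 14 * τ * P := h1
      _ ≤ 14 * (h ^ ρ * u j ^ (-ρ)) * P := by gcongr
      _ = 14 * h ^ ρ * (u j ^ (-ρ) * P + 0) := by ring
      _ ≤ _ := by gcongr; positivity

lemma ofReal_abs_prod_sub_le (a : Fin 3 → ℝ) (ρ h : ℝ) (ha0 : ∀ i, 0 < a i)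
    (ha1 : ∀ i, a i ≤ 1) (hρ0 : 0 < ρ) (hρ1 : ρ ≤ 1) (hh : 0 < h) (A B : E3)
    (hAB : ∀ i, |A i - B i| ≤ h) :
    ENNReal.ofReal |∏ i, |A i| ^ (-a i) - ∏ i, |B i| ^ (-a i)| ≤
      ENNReal.ofReal (14 * h ^ ρ) *
        ∑ j, (powKernel (a + Pi.single j ρ) A + powKernel (a + Pi.single j ρ) B) := by
  have hhρ : 0 < 14 * h ^ ρ := by positivity
  have hne : ENNReal.ofReal (14 * h ^ ρ) ≠ 0 := by
    rw [ne_eq, ENNReal.ofReal_eq_zero, not_le]; exact hhρ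
  have hb (j i : Fin 3) : 0 < (a + Pi.single j ρ : Fin 3 → ℝ) i := by
    have : 0 ≤ (Pi.single j ρ : Fin 3 → ℝ) i := by
      rw [Pi.single_apply]; split_ifs <;> linarith
    simp only [Pi.add_apply]
    linarith [ha0 i]
  by_cases hz : ∃ i, A i = 0 ∨ B i = 0
  · obtain ⟨i, hi⟩ := hz
    have : ∑ j, (powKernel (a + Pi.single j ρ) A + powKernel (a + Pi.single j ρ) B) = ⊤ := by
      refine ENNReal.sum_eq_top.2 ⟨0, Finset.mem_univ _, ?_⟩
      rcases hi with hi | hi <;> simp [powKernel_eq_top (hb 0) hi]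
    rw [this, ENNReal.mul_top hne]
    exact le_top
  push Not at hz
  obtain ⟨j, hj⟩ := exists_abs_prod_rpow_sub_le a (fun i => |A i|) (fun i => |B i|) ρ h
    (fun i => (ha0 i).le) ha1 hρ0.le hρ1 hh (fun i => abs_pos.2 (hz i).1)
    (fun i => abs_pos.2 (hz i).2) (fun i => (abs_abs_sub_abs_le_abs_sub _ _).trans (hAB i))
  have hk (z : E3) (hz : ∀ i, z i ≠ 0) : powKernel (a + Pi.single j ρ) z =
      ENNReal.ofReal (|z j| ^ (-ρ) * ∏ i, |z i| ^ (-a i)) := by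
    rw [powKernel_eq_ofReal hz]
    congr 1
    have : |z j| ^ (-ρ) = ∏ i, |z i| ^ (-(Pi.single j ρ : Fin 3 → ℝ) i) := by
      rw [Finset.prod_eq_single j]
      · simp
      · intro i _ hij; simp [hij]
      · simp
    rw [this, ← Finset.prod_mul_distrib]
    refine Finset.prod_congr rfl fun i _ => ?_
    rw [← Real.rpow_add (abs_pos.2 (hz i)), Pi.add_apply, neg_add, add_comm]
  calc _ ≤ ENNReal.ofReal (14 * h ^ ρ * (|A j| ^ (-ρ) * ∏ i, |A i| ^ (-a i) +
          |B j| ^ (-ρ) * ∏ i, |B i| ^ (-a i))) := ENNReal.ofReal_le_ofReal hj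
    _ = ENNReal.ofReal (14 * h ^ ρ) *
        (powKernel (a + Pi.single j ρ) A + powKernel (a + Pi.single j ρ) B) := by
        rw [ENNReal.ofReal_mul hhρ.le, hk A fun i => (hz i).1, hk B fun i => (hz i).2,
          ENNReal.ofReal_add (by positivity) (by positivity)]
    _ ≤ _ := by
        refine mul_le_mul_right ?_ _
        generalize hg : (fun j => powKernel (a + Pi.single j ρ) A +
          powKernel (a + Pi.single j ρ) B) = g
        rw [show powKernel (a + Pi.single j ρ) A + powKernel (a + Pi.single j ρ) B = g j from
          congrFun hg j]
        exact Finset.single_le_sum (fun _ _ => zero_le) (Finset.mem_univ j)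


lemma fracKernel_eq_prod (H₁ H₂ H₃ : ℝ) (z : E3) :
    fracKernel H₁ H₂ H₃ z =
      ∏ i, |z i| ^ (-(![2 - 2 * H₁, 2 - 2 * H₂, 2 - 2 * H₃] : Fin 3 → ℝ) i) := by
  simp [fracKernel, Fin.prod_univ_three]

lemma lintegral_sphereMeasure (g : E3 → ℝ≥0∞) :
    ∫⁻ ξ, g ξ ∂sphereMeasure =
      ∫⁻ ξ : Metric.sphere (0 : E3) 1, g ξ ∂(volume : Measure E3).toSphere := by
  have hemb : MeasurableEmbedding (fun x : Metric.sphere (0 : E3) 1 => (x : E3)) :=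
    MeasurableEmbedding.subtype_coe (Metric.isClosed_sphere (x := (0 : E3)) (ε := 1)).measurableSet
  rw [sphereMeasure, hemb.lintegral_map]

/-- Integrated over pairs of points of the sphere, the rectangular increment of a product of powers
is controlled by integrals of more singular products of powers, at unmixed endpoints. -/
lemma lintegral_rect_increment_le (a : Fin 3 → ℝ) (ρ s h : ℝ) (ha0 : ∀ i, 0 < a i)
    (ha1 : ∀ i, a i ≤ 1) (hρ0 : 0 < ρ) (hρ1 : ρ ≤ 1) (hh : 0 < h) (f : E3 → ℝ)
    (hf : ∀ z, f z = ∏ i, |z i| ^ (-a i)) :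
    ∫⁻ ξ : Metric.sphere (0 : E3) 1, ∫⁻ η : Metric.sphere (0 : E3) 1,
        ENNReal.ofReal
          (|f (s • ((ξ : E3) + (η : E3)) + h • ((ξ : E3) + (η : E3)))
              - f (s • ((ξ : E3) + (η : E3)) + h • (ξ : E3))
              - f (s • ((ξ : E3) + (η : E3)) + h • (η : E3))
              + f (s • ((ξ : E3) + (η : E3)))| * s ^ 2)
        ∂(volume : Measure E3).toSphere ∂(volume : Measure E3).toSphere ≤
      ENNReal.ofReal (14 * h ^ ρ) * ∑ j, ((sphereInt (a + Pi.single j ρ) (s + h) (s + h) +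
        sphereInt (a + Pi.single j ρ) (s + h) s + sphereInt (a + Pi.single j ρ) s (s + h) +
        sphereInt (a + Pi.single j ρ) s s) * ENNReal.ofReal (s ^ 2)) := by
  have hb (j i : Fin 3) : 0 < (a + Pi.single j ρ : Fin 3 → ℝ) i := by
    have : 0 ≤ (Pi.single j ρ : Fin 3 → ℝ) i := by
      rw [Pi.single_apply]; split_ifs <;> linarith
    simp only [Pi.add_apply]
    linarith [ha0 i]
  let G : Fin 3 → ℝ → ℝ → E3 → E3 → ℝ≥0∞ := fun j p q ξ η =>
    powKernel (a + Pi.single j ρ) (p • ξ + q • η)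
  have hG (j p q) : Measurable fun z : Metric.sphere (0 : E3) 1 × Metric.sphere (0 : E3) 1 =>
      G j p q z.1 z.2 := (continuous_powKernel (hb j)).measurable.comp (by fun_prop)
  have hG1 (j p q) (ξ : E3) : Measurable fun η : Metric.sphere (0 : E3) 1 => G j p q ξ η :=
    (continuous_powKernel (hb j)).measurable.comp (by fun_prop)
  have hG2 (j p q) : Measurable fun ξ : Metric.sphere (0 : E3) 1 =>
      ∫⁻ η : Metric.sphere (0 : E3) 1, G j p q ξ η ∂(volume : Measure E3).toSphere :=
    (hG j p q).lintegral_prod_right'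
  have hpt : ∀ ξ η : Metric.sphere (0 : E3) 1,
      ENNReal.ofReal
          (|f (s • ((ξ : E3) + (η : E3)) + h • ((ξ : E3) + (η : E3)))
              - f (s • ((ξ : E3) + (η : E3)) + h • (ξ : E3))
              - f (s • ((ξ : E3) + (η : E3)) + h • (η : E3))
              + f (s • ((ξ : E3) + (η : E3)))| * s ^ 2) ≤
      ENNReal.ofReal (14 * h ^ ρ) * ∑ j, ((G j (s + h) (s + h) ξ η + G j (s + h) s ξ η +
        G j s (s + h) ξ η + G j s s ξ η) * ENNReal.ofReal (s ^ 2)) := by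
    intro ξ η
    have hA : s • ((ξ : E3) + (η : E3)) + h • ((ξ : E3) + (η : E3)) =
      (s + h) • (ξ : E3) + (s + h) • (η : E3) := by module
    have hB : s • ((ξ : E3) + (η : E3)) + h • (ξ : E3) =
      (s + h) • (ξ : E3) + s • (η : E3) := by module
    have hC : s • ((ξ : E3) + (η : E3)) + h • (η : E3) =
      s • (ξ : E3) + (s + h) • (η : E3) := by module
    have hD : s • ((ξ : E3) + (η : E3)) = s • (ξ : E3) + s • (η : E3) := by module
    have hη (i : Fin 3) : |h * (η : E3) i| ≤ h := by
      have h1 : |(η : E3) i| ≤ 1 :=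
        (PiLp.norm_apply_le (η : E3) i).trans (mem_sphere_zero_iff_norm.1 η.2).le
      rw [abs_mul, abs_of_pos hh]
      nlinarith
    rw [hA, hB, hC, hD]
    set A := (s + h) • (ξ : E3) + (s + h) • (η : E3)
    set B := (s + h) • (ξ : E3) + s • (η : E3)
    set C := s • (ξ : E3) + (s + h) • (η : E3)
    set D := s • (ξ : E3) + s • (η : E3)
    have h1 := ofReal_abs_prod_sub_le a ρ h ha0 ha1 hρ0 hρ1 hh A B (fun i => by
      convert hη i using 2; simp [A, B]; ring)
    have h2 := ofReal_abs_prod_sub_le a ρ h ha0 ha1 hρ0 hρ1 hh C D (fun i => by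
      convert hη i using 2; simp [C, D]; ring)
    rw [← hf, ← hf] at h1 h2
    calc ENNReal.ofReal (|f A - f B - f C + f D| * s ^ 2)
        ≤ ENNReal.ofReal ((|f A - f B| + |f C - f D|) * s ^ 2) := by
          refine ENNReal.ofReal_le_ofReal ?_
          gcongr
          calc |f A - f B - f C + f D| = |(f A - f B) - (f C - f D)| := by ring_nf
            _ ≤ _ := abs_sub _ _
      _ = (ENNReal.ofReal |f A - f B| + ENNReal.ofReal |f C - f D|) * ENNReal.ofReal (s ^ 2) := by
          rw [ENNReal.ofReal_mul (by positivity), ENNReal.ofReal_add (abs_nonneg _) (abs_nonneg _)]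
      _ ≤ _ := by
          refine (mul_le_mul_left (add_le_add h1 h2) _).trans (le_of_eq ?_)
          rw [← mul_add, ← Finset.sum_add_distrib, mul_assoc, Finset.sum_mul]
          simp only [G, A, B, C, D, add_assoc]
  refine (lintegral_mono fun ξ => lintegral_mono fun η => hpt ξ η).trans (le_of_eq ?_)
  have hinner (ξ : Metric.sphere (0 : E3) 1) :
      ∫⁻ η : Metric.sphere (0 : E3) 1, ENNReal.ofReal (14 * h ^ ρ) *
        ∑ j, ((G j (s + h) (s + h) ξ η + G j (s + h) s ξ η +
        G j s (s + h) ξ η + G j s s ξ η) * ENNReal.ofReal (s ^ 2))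
          ∂(volume : Measure E3).toSphere =
      ENNReal.ofReal (14 * h ^ ρ) *
        ∑ j, ((∫⁻ η : Metric.sphere (0 : E3) 1, G j (s + h) (s + h) ξ η
              ∂(volume : Measure E3).toSphere +
            ∫⁻ η : Metric.sphere (0 : E3) 1, G j (s + h) s ξ η ∂(volume : Measure E3).toSphere +
            ∫⁻ η : Metric.sphere (0 : E3) 1, G j s (s + h) ξ η ∂(volume : Measure E3).toSphere +
            ∫⁻ η : Metric.sphere (0 : E3) 1, G j s s ξ η ∂(volume : Measure E3).toSphere) *
          ENNReal.ofReal (s ^ 2)) := by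
    rw [lintegral_const_mul' _ _ ENNReal.ofReal_ne_top, lintegral_finsetSum]
    · congr 1
      refine Finset.sum_congr rfl fun j _ => ?_
      rw [lintegral_mul_const' _ _ ENNReal.ofReal_ne_top, lintegral_add_right _ (hG1 j s s ξ),
        lintegral_add_right _ (hG1 j s (s + h) ξ), lintegral_add_right _ (hG1 j (s + h) s ξ)]
    · intro j _
      exact ((((hG1 j _ _ ξ).add (hG1 j _ _ ξ)).add (hG1 j _ _ ξ)).add (hG1 j _ _ ξ)).mul_const _
  simp only [hinner]
  rw [lintegral_const_mul' _ _ ENNReal.ofReal_ne_top, lintegral_finsetSum]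
  · congr 1
    refine Finset.sum_congr rfl fun j _ => ?_
    rw [lintegral_mul_const' _ _ ENNReal.ofReal_ne_top, lintegral_add_right _ (hG2 j s s),
      lintegral_add_right _ (hG2 j s (s + h)), lintegral_add_right _ (hG2 j (s + h) s)]
    rfl
  · intro j _
    exact ((((hG2 j _ _).add (hG2 j _ _)).add (hG2 j _ _)).add (hG2 j _ _)).mul_const _

/-- Condition (4.2) of Theorem 4.1 for the fractional kernel: for
`0 < ρ₂ < min(2H₁-1, 2H₂-1, 2H₃-1, 2κ̄)` there is `C > 0` such that for all `0 < h ≤ 1`,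
`∫₀^T ∫_{S²} ∫_{S²} |f(s(ξ+η)+h(ξ+η)) - f(s(ξ+η)+hξ) - f(s(ξ+η)+hη) + f(s(ξ+η))| s²
  σ(dξ) σ(dη) ds ≤ C h^{ρ₂}`. -/
theorem frac_time_condition_two
    (H₁ H₂ H₃ κ T ρ₂ : ℝ)
    (h₁ : H₁ ∈ Set.Ioo (1/2 : ℝ) 1) (h₂ : H₂ ∈ Set.Ioo (1/2 : ℝ) 1)
    (h₃ : H₃ ∈ Set.Ioo (1/2 : ℝ) 1)
    (hsum : 2 < H₁ + H₂ + H₃) (hκ : κ = H₁ + H₂ + H₃ - 2) (hT : 0 < T)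
    (hρ0 : 0 < ρ₂)
    (hρ2 : ρ₂ < min (2 * H₁ - 1) (min (2 * H₂ - 1) (min (2 * H₃ - 1) (2 * κ)))) :
    ∃ C : ℝ, 0 < C ∧ ∀ h : ℝ, 0 < h → h ≤ 1 →
      (∫⁻ s in Set.Ioc (0 : ℝ) T, ∫⁻ ξ, ∫⁻ η,
          ENNReal.ofReal
            (|fracKernel H₁ H₂ H₃ (s • (ξ + η) + h • (ξ + η))
                - fracKernel H₁ H₂ H₃ (s • (ξ + η) + h • ξ)
                - fracKernel H₁ H₂ H₃ (s • (ξ + η) + h • η)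
                + fracKernel H₁ H₂ H₃ (s • (ξ + η))| * s ^ 2)
        ∂sphereMeasure ∂sphereMeasure)
      ≤ ENNReal.ofReal (C * h ^ ρ₂) := by
  have hρ := hρ2
  simp only [lt_min_iff] at hρ
  obtain ⟨hρ_1, hρ_2, hρ_3, hρ_4⟩ := hρ
  obtain ⟨h₁l, h₁u⟩ := h₁
  obtain ⟨h₂l, h₂u⟩ := h₂
  obtain ⟨h₃l, h₃u⟩ := h₃
  set a : Fin 3 → ℝ := ![2 - 2 * H₁, 2 - 2 * H₂, 2 - 2 * H₃] with ha
  have ha0 : ∀ i, 0 < a i := by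
    intro i; fin_cases i <;> simp [ha] <;> linarith
  have haρ : ∀ i, a i + ρ₂ < 1 := by
    intro i; fin_cases i <;> simp [ha] <;> linarith
  have hsum' : ∑ i, a i + ρ₂ < 2 := by
    simp [ha, Fin.sum_univ_three]; linarith
  have hD (j : Fin 3) := exists_sphereInt_mul_sq_le (b := a + Pi.single j ρ₂)
    (fun i => by
      simp only [Pi.add_apply, Pi.single_apply]; split_ifs <;> linarith [ha0 i])
    (fun i => by
      simp only [Pi.add_apply, Pi.single_apply]; split_ifs <;> linarith [haρ i])
    (by simpa [Finset.sum_add_distrib] using hsum') (T + 1)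
  choose D hDtop hD using hD
  have hDsum : ∑ j, 4 * D j ≠ ⊤ :=
    ENNReal.sum_ne_top.2 fun j _ => ENNReal.mul_ne_top (by simp) (hDtop j)
  set M := (∑ j, 4 * D j).toReal with hM
  have hM0 : 0 ≤ M := ENNReal.toReal_nonneg
  refine ⟨14 * M * T + 1, by positivity, fun h hh hh1 => ?_⟩
  have hhρ : 0 < h ^ ρ₂ := Real.rpow_pos_of_pos hh _
  have hs : ∀ s ∈ Set.Ioc (0 : ℝ) T, (∫⁻ ξ, ∫⁻ η,
      ENNReal.ofReal
            (|fracKernel H₁ H₂ H₃ (s • (ξ + η) + h • (ξ + η))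
                - fracKernel H₁ H₂ H₃ (s • (ξ + η) + h • ξ)
                - fracKernel H₁ H₂ H₃ (s • (ξ + η) + h • η)
                + fracKernel H₁ H₂ H₃ (s • (ξ + η))| * s ^ 2)
        ∂sphereMeasure ∂sphereMeasure) ≤ ENNReal.ofReal (14 * h ^ ρ₂ * M) := by
    rintro s ⟨hs0, hsT⟩
    simp only [lintegral_sphereMeasure]
    refine (lintegral_rect_increment_le a ρ₂ s h ha0 (fun i => by linarith [haρ i]) hρ0
      (by linarith) hh (fracKernel H₁ H₂ H₃) (fracKernel_eq_prod H₁ H₂ H₃)).trans ?_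
    rw [ENNReal.ofReal_mul (p := 14 * h ^ ρ₂) (q := M) (by positivity), hM,
      ENNReal.ofReal_toReal hDsum]
    refine mul_le_mul_right (Finset.sum_le_sum fun j _ => ?_) _
    have hle : s ≤ s + h := by linarith
    have hT1 : s + h ≤ T + 1 := by linarith
    have hT2 : s ≤ T + 1 := by linarith
    calc _ ≤ D j + D j + D j + D j := by
          simp only [add_mul]
          exact add_le_add (add_le_add (add_le_add (hD j s _ _ hs0 hle hle hT1 hT1)
            (hD j s _ _ hs0 hle le_rfl hT1 hT2)) (hD j s _ _ hs0 le_rfl hle hT2 hT1))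
            (hD j s _ _ hs0 le_rfl le_rfl hT2 hT2)
      _ = 4 * D j := by ring
  calc _ ≤ ∫⁻ _ in Set.Ioc (0 : ℝ) T, ENNReal.ofReal (14 * h ^ ρ₂ * M) :=
        setLIntegral_mono' measurableSet_Ioc hs
    _ = ENNReal.ofReal (14 * h ^ ρ₂ * M * T) := by
        rw [setLIntegral_const, Real.volume_Ioc, sub_zero, ← ENNReal.ofReal_mul (by positivity)]
    _ ≤ _ := by
        refine ENNReal.ofReal_le_ofReal ?_
        nlinarith
end
end

section
/- Let H₁, H₂, H₃ ∈ (1/2, 1) with H₁ + H₂ + H₃ > 2, set κ̄ = H₁ + H₂ + H₃ − 2, and fix 0 < t₀ ≤ T. For 0 ≤ t < t̄ ≤ T define Z₂(t, t̄) = ∫₀^t ∫_{ℝ³} |ξ₁|^{1−2H₁}|ξ₂|^{1−2H₂}|ξ₃|^{1−2H₃} |ξ|⁻² (sin((t̄−s)|ξ|) − sin((t−s)|ξ|))² dξ ds. Then: (i) there exists c₂ > 0 such that Z₂(t, t̄) ≤ c₂ (t̄−t)^{2κ̄} for all 0 ≤ t < t̄ ≤ T; and (ii) there exist c₁ > 0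 and δ > 0 such that Z₂(t, t̄) ≥ c₁ (t̄−t)^{2κ̄} for all t₀ ≤ t < t̄ ≤ T with t̄ − t ≤ δ. -/
open MeasureTheory Real
open scoped ENNReal

noncomputable section

/-- `Z₂(t, t̄) = ∫₀^t ∫_{ℝ³} |ξ₁|^{1-2H₁}|ξ₂|^{1-2H₂}|ξ₃|^{1-2H₃} |ξ|⁻²
(sin((t̄-s)|ξ|) - sin((t-s)|ξ|))² dξ ds`, the (nonnegative) integrand being
integrated in `[0,∞]`. -/
def Ztwo (H₁ H₂ H₃ : ℝ) (t tbar : ℝ) : ℝ≥0∞ :=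
  ∫⁻ s in Set.Ioc (0 : ℝ) t, ∫⁻ ξ : E3, ENNReal.ofReal
    (|ξ 0| ^ (1 - 2 * H₁) * |ξ 1| ^ (1 - 2 * H₂) * |ξ 2| ^ (1 - 2 * H₃)
      * (‖ξ‖ ^ 2)⁻¹ * (Real.sin ((tbar - s) * ‖ξ‖) - Real.sin ((t - s) * ‖ξ‖)) ^ 2)

/-- A Japanese-bracket bound with a possible power singularity at the origin is integrable on the
half-line. -/
theorem integrableOn_Ioi_abs_rpow_mul_one_add_sq_rpow {a q : ℝ} (ha : -1 < a)
    (hq : 0 ≤ q) (haq : a - 2 * q < -1) :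
    IntegrableOn (fun x : ℝ => |x| ^ a * (1 + x ^ 2) ^ (-q)) (Set.Ioi 0) := by
  rw [← Set.Ioc_union_Ioi_eq_Ioi (zero_le_one' ℝ)]
  have hmeas : Measurable (fun x : ℝ => |x| ^ a * (1 + x ^ 2) ^ (-q)) := by fun_prop
  refine IntegrableOn.union ?_ ?_
  · have h := (intervalIntegral.intervalIntegrable_rpow' (a := 0) (b := 1) ha).1
    refine Integrable.mono' h hmeas.aestronglyMeasurable ?_
    refine (ae_restrict_iff' measurableSet_Ioc).2 (Filter.Eventually.of_forall fun x hx => ?_)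
    have hx0 : 0 < x := hx.1
    rw [Real.norm_of_nonneg (by positivity), abs_of_pos hx0]
    refine mul_le_of_le_one_right (by positivity) ?_
    exact Real.rpow_le_one_of_one_le_of_nonpos (by nlinarith [sq_nonneg x]) (by linarith)
  · have h := integrableOn_Ioi_rpow_of_lt haq one_pos
    refine Integrable.mono' h hmeas.aestronglyMeasurable ?_
    refine (ae_restrict_iff' measurableSet_Ioi).2 (Filter.Eventually.of_forall fun x hx => ?_)
    have hx0 : 0 < x := lt_trans one_pos hx
    rw [Real.norm_of_nonneg (by positivity), abs_of_pos hx0, sub_eq_add_neg, Real.rpow_add hx0]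
    refine mul_le_mul_of_nonneg_left ?_ (by positivity)
    rw [← mul_neg, Real.rpow_mul hx0.le, Real.rpow_two]
    exact Real.rpow_le_rpow_of_nonpos (by positivity) (by linarith) (by linarith)

theorem integrable_abs_rpow_mul_one_add_sq_rpow {a q : ℝ} (ha : -1 < a)
    (hq : 0 ≤ q) (haq : a - 2 * q < -1) :
    Integrable (fun x : ℝ => |x| ^ a * (1 + x ^ 2) ^ (-q)) := by
  have h := integrableOn_Ioi_abs_rpow_mul_one_add_sq_rpow ha hq haq
  rw [← integrableOn_univ, ← Set.Iic_union_Ioi (a := (0 : ℝ))]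
  refine IntegrableOn.union ?_ h
  have h' := (integrableOn_Ici_iff_integrableOn_Ioi (μ := volume)).2 h
  rw [← neg_zero, ← Set.neg_Ici]
  simpa using h'.comp_neg

theorem abs_rpow_mul_one_add_sq_rpow_comp_mul {a q h : ℝ} (hh : 0 < h) (x : ℝ) :
    |x| ^ a * (1 + (h * x) ^ 2) ^ (-q) =
      h ^ (-a) * (|h * x| ^ a * (1 + (h * x) ^ 2) ^ (-q)) := by
  rw [abs_mul, abs_of_pos hh, Real.mul_rpow hh.le (abs_nonneg x), Real.rpow_neg hh.le]
  have : h ^ a ≠ 0 := (Real.rpow_pos_of_pos hh a).ne'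
  field_simp

theorem integral_abs_rpow_mul_one_add_sq_rpow_comp_mul (a q : ℝ) {h : ℝ} (hh : 0 < h) :
    ∫ x : ℝ, |x| ^ a * (1 + (h * x) ^ 2) ^ (-q) =
      h ^ (-a - 1) * ∫ x : ℝ, |x| ^ a * (1 + x ^ 2) ^ (-q) := by
  simp_rw [abs_rpow_mul_one_add_sq_rpow_comp_mul hh]
  rw [integral_const_mul,
    Measure.integral_comp_mul_left (fun x : ℝ => |x| ^ a * (1 + x ^ 2) ^ (-q)) h,
    abs_of_pos (inv_pos.2 hh), smul_eq_mul, ← mul_assoc, Real.rpow_sub_one hh.ne', div_eq_mul_inv]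

theorem integrable_abs_rpow_mul_one_add_sq_rpow_comp_mul {a q h : ℝ} (ha : -1 < a)
    (hq : 0 ≤ q) (haq : a - 2 * q < -1) (hh : 0 < h) :
    Integrable (fun x : ℝ => |x| ^ a * (1 + (h * x) ^ 2) ^ (-q)) := by
  simp_rw [abs_rpow_mul_one_add_sq_rpow_comp_mul hh]
  exact ((integrable_abs_rpow_mul_one_add_sq_rpow ha hq haq).comp_mul_left' hh.ne').const_mul _

theorem inv_sq_mul_sin_sub_sin_sq_le {A B h r : ℝ} (hAB : A - B = h * r) :
    (r ^ 2)⁻¹ * (Real.sin A - Real.sin B) ^ 2 ≤ 5 * h ^ 2 * (1 + h ^ 2 * r ^ 2)⁻¹ := by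
  have h1 : (Real.sin A - Real.sin B) ^ 2 ≤ h ^ 2 * r ^ 2 := by
    rw [← mul_pow, ← hAB]
    exact sq_le_sq.2 (Real.abs_sin_sub_sin_le A B)
  have h2 : (Real.sin A - Real.sin B) ^ 2 ≤ 4 := by
    nlinarith [Real.sin_sq_le_one A, Real.sin_sq_le_one B, sq_nonneg (Real.sin A + Real.sin B)]
  rcases eq_or_ne r 0 with rfl | hr
  · simp; positivity
  · have hr2 : 0 < r ^ 2 := by positivity
    rw [inv_mul_eq_div, ← div_eq_mul_inv, div_le_div_iff₀ hr2 (by positivity)]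
    nlinarith [mul_le_mul_of_nonneg_right h2 (by positivity : 0 ≤ h ^ 2 * r ^ 2)]

theorem inv_one_add_norm_sq_le_prod {q : Fin 3 → ℝ} (hq : ∀ i, 0 ≤ q i) (hq1 : ∑ i, q i = 1)
    (h : ℝ) (ξ : E3) :
    (1 + h ^ 2 * ‖ξ‖ ^ 2)⁻¹ ≤ ∏ i, (1 + (h * ξ i) ^ 2) ^ (-q i) := by
  have hpos : 0 < 1 + h ^ 2 * ‖ξ‖ ^ 2 := by positivity
  calc (1 + h ^ 2 * ‖ξ‖ ^ 2)⁻¹ = ∏ i, (1 + h ^ 2 * ‖ξ‖ ^ 2) ^ (-q i) := by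
        rw [← Real.rpow_sum_of_pos hpos, Finset.sum_neg_distrib, hq1, Real.rpow_neg_one]
    _ ≤ _ := by
        refine Finset.prod_le_prod (fun i _ => by positivity) fun i _ => ?_
        refine Real.rpow_le_rpow_of_nonpos (by positivity) ?_ (by linarith [hq i])
        rw [mul_pow]
        have : ξ i ^ 2 ≤ ‖ξ‖ ^ 2 := by
          simpa using pow_le_pow_left₀ (norm_nonneg _) (PiLp.norm_apply_le ξ i) 2
        gcongr

/-- The spatial integral at a fixed time is bounded, by scaling, by a multiple of `h ^ (2κ)`. -/
theorem lintegral_prod_mul_sin_sub_sin_sq_le {H : Fin 3 → ℝ} {κ : ℝ}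
    (hH : ∀ i, H i ∈ Set.Ioo (1/2 : ℝ) 1) (hκ : ∑ i, H i = κ + 2) (hκ0 : 0 < κ) :
    ∃ C : ℝ, 0 ≤ C ∧ ∀ h : ℝ, 0 < h → ∀ α β : ℝ, α - β = h →
      ∫⁻ ξ : E3, ENNReal.ofReal ((∏ i, |ξ i| ^ (1 - 2 * H i)) * (‖ξ‖ ^ 2)⁻¹ *
        (Real.sin (α * ‖ξ‖) - Real.sin (β * ‖ξ‖)) ^ 2) ≤ ENNReal.ofReal (C * h ^ (2 * κ)) := by
  set q : Fin 3 → ℝ := fun i => 1 - H i + κ / 3 with hqdef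
  have hq : ∀ i, 0 ≤ q i := fun i => by have := (hH i).2; simp only [hqdef]; linarith
  have hq1 : ∑ i, q i = 1 := by
    simp only [hqdef, Fin.sum_univ_three] at hκ ⊢; linarith
  refine ⟨5 * ∏ i, ∫ x : ℝ, |x| ^ (1 - 2 * H i) * (1 + x ^ 2) ^ (-q i), ?_, ?_⟩
  · refine mul_nonneg (by norm_num) (Finset.prod_nonneg fun i _ => integral_nonneg fun x => ?_)
    positivity
  intro h hh α β hαβ
  set g : Fin 3 → ℝ → ℝ := fun i x => |x| ^ (1 - 2 * H i) * (1 + (h * x) ^ 2) ^ (-q i) with hg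
  have hgi : ∀ i, Integrable (g i) := fun i =>
    integrable_abs_rpow_mul_one_add_sq_rpow_comp_mul (by linarith [(hH i).2]) (hq i)
      (by simp only [hqdef]; linarith) hh
  have hg0 : ∀ x : Fin 3 → ℝ, 0 ≤ ∏ i, g i (x i) := fun x =>
    Finset.prod_nonneg fun i _ => by simp only [hg]; positivity
  have hint : Integrable (fun x : Fin 3 → ℝ => ∏ i, g i (x i)) := Integrable.fintype_prod hgi
  calc _ ≤ ∫⁻ ξ : E3, ENNReal.ofReal (5 * h ^ 2 * ∏ i, g i (ξ i)) := by
        refine lintegral_mono fun ξ => ENNReal.ofReal_le_ofReal ?_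
        rw [mul_assoc, Finset.prod_mul_distrib, mul_left_comm (5 * h ^ 2)]
        refine mul_le_mul_of_nonneg_left ?_ (Finset.prod_nonneg fun i _ => by positivity)
        refine (inv_sq_mul_sin_sub_sin_sq_le (h := h) (by rw [← hαβ]; ring)).trans ?_
        exact mul_le_mul_of_nonneg_left (inv_one_add_norm_sq_le_prod hq hq1 h ξ) (by positivity)
    _ = ∫⁻ x : Fin 3 → ℝ, ENNReal.ofReal (5 * h ^ 2 * ∏ i, g i (x i)) :=
        (PiLp.volume_preserving_ofLp (Fin 3)).lintegral_comp
          (f := fun x => ENNReal.ofReal (5 * h ^ 2 * ∏ i, g i (x i))) (by fun_prop)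
    _ = ENNReal.ofReal (5 * h ^ 2 * ∏ i, ∫ x, g i x) := by
        rw [← ofReal_integral_eq_lintegral_ofReal (hint.const_mul _)
          (Filter.Eventually.of_forall fun x => mul_nonneg (by positivity) (hg0 x)),
          integral_const_mul, integral_fintype_prod_volume_eq_prod]
    _ = _ := by
        congr 1
        simp only [hg, integral_abs_rpow_mul_one_add_sq_rpow_comp_mul _ _ hh,
          Finset.prod_mul_distrib]
        rw [← Real.rpow_sum_of_pos hh]
        have hexp : h ^ (2 * κ) = h ^ 2 * h ^ (∑ i, (-(1 - 2 * H i) - 1)) := by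
          rw [← Real.rpow_two, ← Real.rpow_add hh]
          congr 1
          simp only [Fin.sum_univ_three] at hκ ⊢
          linarith
        rw [hexp]; ring

theorem integral_cos_sq_sub_mul {a r : ℝ} (hr : r ≠ 0) (t : ℝ) :
    ∫ s in (0 : ℝ)..t, Real.cos ((a - s) * r) ^ 2 =
      t / 2 - (Real.sin (2 * ((a - t) * r)) - Real.sin (2 * (a * r))) / (4 * r) := by
  have hd : ∀ x ∈ Set.uIcc (0 : ℝ) t,
      HasDerivAt (fun s => s / 2 - Real.sin (2 * ((a - s) * r)) / (4 * r))
        (Real.cos ((a - x) * r) ^ 2) x := by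
    intro x _
    have h1 : HasDerivAt (fun s : ℝ => 2 * ((a - s) * r)) (2 * (-1 * r)) x :=
      (((hasDerivAt_id x).const_sub a).mul_const r).const_mul 2
    have h2 := ((hasDerivAt_id x).div_const 2).sub (h1.sin.div_const (4 * r))
    refine h2.congr_deriv ?_
    rw [Real.cos_sq]
    field_simp
    ring
  rw [intervalIntegral.integral_eq_sub_of_hasDerivAt hd
    (Continuous.intervalIntegrable (by fun_prop) _ _)]
  simp
  ring

theorem le_lintegral_cos_sq {a r t t₀ : ℝ} (ht₀ : 0 < t₀) (ht : t₀ ≤ t) (hr : 2 / t₀ ≤ r) :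
    ENNReal.ofReal (t₀ / 4) ≤
      ∫⁻ s in Set.Ioc (0 : ℝ) t, ENNReal.ofReal (Real.cos ((a - s) * r) ^ 2) := by
  have hr0 : 0 < r := lt_of_lt_of_le (by positivity) hr
  have hc : IntervalIntegrable (fun s => Real.cos ((a - s) * r) ^ 2) volume 0 t :=
    Continuous.intervalIntegrable (by fun_prop) _ _
  rw [← ofReal_integral_eq_lintegral_ofReal hc.1
    (Filter.Eventually.of_forall fun s => sq_nonneg _),
    ← intervalIntegral.integral_of_le (ht₀.le.trans ht), integral_cos_sq_sub_mul hr0.ne']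
  refine ENNReal.ofReal_le_ofReal ?_
  have h1 : (Real.sin (2 * ((a - t) * r)) - Real.sin (2 * (a * r))) / (4 * r) ≤ t₀ / 4 := by
    rw [div_le_iff₀ (by positivity)]
    have := (div_le_iff₀ ht₀).1 hr
    nlinarith [Real.sin_le_one (2 * ((a - t) * r)), Real.neg_one_le_sin (2 * (a * r))]
  linarith

/-- The open cube of side `1 / (2h)` on which all frequencies are of order `1 / h`. -/
def frequencyCube (h : ℝ) : Set E3 := {ξ | ∀ i, ξ i ∈ Set.Ioo (1 / (2 * h)) (1 / h)}

theorem frequencyCube_eq_preimage (h : ℝ) : frequencyCube h =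
    WithLp.ofLp ⁻¹' (Set.univ.pi fun _ : Fin 3 => Set.Ioo (1 / (2 * h)) (1 / h)) := by
  ext ξ; simp [frequencyCube]

theorem measurableSet_frequencyCube (h : ℝ) : MeasurableSet (frequencyCube h) := by
  rw [frequencyCube_eq_preimage]
  exact (PiLp.volume_preserving_ofLp (Fin 3)).measurable
    (MeasurableSet.univ_pi fun _ => measurableSet_Ioo)

theorem volume_frequencyCube {h : ℝ} (hh : 0 < h) :
    volume (frequencyCube h) = ENNReal.ofReal ((1 / (2 * h)) ^ 3) := by
  rw [frequencyCube_eq_preimage, (PiLp.volume_preserving_ofLp (Fin 3)).measure_preimage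
    (MeasurableSet.univ_pi fun _ => measurableSet_Ioo).nullMeasurableSet, Real.volume_pi_Ioo,
    Finset.prod_const, Finset.card_univ, Fintype.card_fin, ENNReal.ofReal_pow (by positivity)]
  congr 2
  field_simp
  norm_num

theorem norm_bounds_of_mem_frequencyCube {h : ℝ} (hh : 0 < h) {ξ : E3}
    (hξ : ξ ∈ frequencyCube h) : 1 / (2 * h) ≤ ‖ξ‖ ∧ ‖ξ‖ ^ 2 ≤ 3 / h ^ 2 := by
  have hp : ∀ i, 0 < ξ i := fun i => lt_trans (by positivity) (hξ i).1
  constructor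
  · have h0 := PiLp.norm_apply_le ξ 0
    rw [Real.norm_of_nonneg (hp 0).le] at h0
    exact (hξ 0).1.le.trans h0
  · have hs : ∀ i, ξ i ^ 2 ≤ 1 / h ^ 2 := fun i => by
      simpa using pow_le_pow_left₀ (hp i).le (hξ i).2.le 2
    rw [EuclideanSpace.norm_sq_eq, Fin.sum_univ_three]
    simp only [Real.norm_eq_abs, sq_abs]
    have : 3 / h ^ 2 = 1 / h ^ 2 + 1 / h ^ 2 + 1 / h ^ 2 := by ring
    linarith [hs 0, hs 1, hs 2]

theorem le_integrand_of_mem_frequencyCube {H : Fin 3 → ℝ} {κ : ℝ}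
    (hH : ∀ i, H i ∈ Set.Ioo (1/2 : ℝ) 1) (hκ : ∑ i, H i = κ + 2) {h : ℝ} (hh : 0 < h)
    {ξ : E3} (hξ : ξ ∈ frequencyCube h) {α β : ℝ} (hαβ : α - β = h) :
    h ^ (2 * κ) * h ^ 3 / 48 * Real.cos ((α + β) / 2 * ‖ξ‖) ^ 2 ≤
      (∏ i, |ξ i| ^ (1 - 2 * H i)) * (‖ξ‖ ^ 2)⁻¹ *
        (Real.sin (α * ‖ξ‖) - Real.sin (β * ‖ξ‖)) ^ 2 := by
  have hp : ∀ i, 0 < ξ i := fun i => lt_trans (by positivity) (hξ i).1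
  obtain ⟨hlo, hup⟩ := norm_bounds_of_mem_frequencyCube hh hξ
  have hr : 0 < ‖ξ‖ := lt_of_lt_of_le (by positivity) hlo
  have hprod : h ^ (2 * κ) * h ≤ ∏ i, |ξ i| ^ (1 - 2 * H i) := by
    calc h ^ (2 * κ) * h = ∏ i, (1 / h) ^ (1 - 2 * H i) := by
          simp_rw [one_div, Real.inv_rpow hh.le, ← Real.rpow_neg hh.le]
          rw [← Real.rpow_sum_of_pos hh, ← Real.rpow_add_one hh.ne']
          congr 1
          simp only [Fin.sum_univ_three] at hκ ⊢
          linarith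
      _ ≤ _ := by
          refine Finset.prod_le_prod (fun i _ => by positivity) fun i _ => ?_
          rw [abs_of_pos (hp i)]
          exact Real.rpow_le_rpow_of_nonpos (hp i) (hξ i).2.le (by linarith [(hH i).1])
  have hinv : h ^ 2 / 3 ≤ (‖ξ‖ ^ 2)⁻¹ := by
    rw [← inv_div]
    exact inv_anti₀ (by positivity) hup
  have hrh : 1 / 4 ≤ h * ‖ξ‖ / 2 := by
    rw [div_le_iff₀ (by positivity)] at hlo
    linarith
  have hrh' : h * ‖ξ‖ / 2 ≤ 1 := by
    rw [le_div_iff₀ (by positivity)] at hup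
    nlinarith [mul_pos hh hr]
  have hsin : 1 / 8 ≤ Real.sin (h * ‖ξ‖ / 2) := by
    refine le_trans ?_ (Real.mul_le_sin (by positivity) (by linarith [Real.pi_gt_three]))
    rw [div_mul_eq_mul_div, le_div_iff₀ Real.pi_pos]
    linarith [Real.pi_le_four]
  have hdiff : 1 / 16 * Real.cos ((α + β) / 2 * ‖ξ‖) ^ 2 ≤
      (Real.sin (α * ‖ξ‖) - Real.sin (β * ‖ξ‖)) ^ 2 := by
    rw [Real.sin_sub_sin, mul_pow, ← sub_mul, hαβ, ← add_mul, mul_div_right_comm (α + β)]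
    refine mul_le_mul_of_nonneg_right ?_ (sq_nonneg _)
    nlinarith
  calc _ = h ^ (2 * κ) * h * (h ^ 2 / 3) * (1 / 16 * Real.cos ((α + β) / 2 * ‖ξ‖) ^ 2) := by ring
    _ ≤ _ := by gcongr

/-- Restricting the frequencies to the cube of scale `1 / h` and integrating first in time gives
the lower bound. -/
theorem le_lintegral_lintegral_prod_mul_sin_sub_sin_sq {H : Fin 3 → ℝ} {κ : ℝ}
    (hH : ∀ i, H i ∈ Set.Ioo (1/2 : ℝ) 1) (hκ : ∑ i, H i = κ + 2) {t₀ t tbar : ℝ}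
    (ht₀ : 0 < t₀) (ht : t₀ ≤ t) (hlt : t < tbar) (hδ : tbar - t ≤ t₀ / 4) :
    ENNReal.ofReal (t₀ / 1536 * (tbar - t) ^ (2 * κ)) ≤
      ∫⁻ s in Set.Ioc (0 : ℝ) t, ∫⁻ ξ : E3, ENNReal.ofReal
        ((∏ i, |ξ i| ^ (1 - 2 * H i)) * (‖ξ‖ ^ 2)⁻¹ *
          (Real.sin ((tbar - s) * ‖ξ‖) - Real.sin ((t - s) * ‖ξ‖)) ^ 2) := by
  set h := tbar - t with hhdef
  have hh : 0 < h := sub_pos.2 hlt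
  set c := h ^ (2 * κ) * h ^ 3 / 48 with hc
  have hc0 : 0 ≤ c := by positivity
  set a := (tbar + t) / 2 with ha
  calc ENNReal.ofReal (t₀ / 1536 * h ^ (2 * κ))
      = ∫⁻ _ξ in frequencyCube h, ENNReal.ofReal c * ENNReal.ofReal (t₀ / 4) := by
        rw [setLIntegral_const, volume_frequencyCube hh, ← ENNReal.ofReal_mul hc0,
          ← ENNReal.ofReal_mul (by positivity)]
        congr 1
        rw [hc]
        field_simp
        norm_num
    _ ≤ ∫⁻ ξ in frequencyCube h, ENNReal.ofReal c *
          ∫⁻ s in Set.Ioc (0 : ℝ) t, ENNReal.ofReal (Real.cos ((a - s) * ‖ξ‖) ^ 2) := by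
        refine setLIntegral_mono' (measurableSet_frequencyCube h) fun ξ hξ => ?_
        gcongr
        refine le_lintegral_cos_sq ht₀ ht
          (le_trans ?_ (norm_bounds_of_mem_frequencyCube hh hξ).1)
        rw [div_le_div_iff₀ ht₀ (by positivity)]
        linarith
    _ = ∫⁻ ξ in frequencyCube h, ∫⁻ s in Set.Ioc (0 : ℝ) t,
          ENNReal.ofReal (c * Real.cos ((a - s) * ‖ξ‖) ^ 2) := by
        refine lintegral_congr fun ξ => ?_
        rw [← lintegral_const_mul _ (by fun_prop)]
        simp_rw [ENNReal.ofReal_mul hc0]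
    _ = ∫⁻ s in Set.Ioc (0 : ℝ) t, ∫⁻ ξ in frequencyCube h,
          ENNReal.ofReal (c * Real.cos ((a - s) * ‖ξ‖) ^ 2) := by
        refine lintegral_lintegral_swap (Measurable.aemeasurable ?_)
        unfold Function.uncurry
        fun_prop
    _ ≤ _ := by
        refine lintegral_mono fun s => ?_
        refine le_trans (setLIntegral_mono' (measurableSet_frequencyCube h) fun ξ hξ => ?_)
          (setLIntegral_le_lintegral (frequencyCube h) _)
        refine ENNReal.ofReal_le_ofReal ?_
        have := le_integrand_of_mem_frequencyCube hH hκ hh hξ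
          (α := tbar - s) (β := t - s) (by rw [hhdef]; ring)
        rwa [show (tbar - s + (t - s)) / 2 = a - s by rw [ha]; ring] at this

/-- Theorem 6.2(b): two-sided bounds on `Z₂`: an upper bound `c₂ (t̄-t)^{2κ̄}` for all
`0 ≤ t < t̄ ≤ T`, and a lower bound `c₁ (t̄-t)^{2κ̄}` for `t₀ ≤ t < t̄ ≤ T` with `t̄-t` small,
showing `κ̄ = H₁+H₂+H₃-2` is the optimal temporal Hölder exponent. -/
theorem frac_time_optimality
    (H₁ H₂ H₃ κ t₀ T : ℝ)
    (h₁ : H₁ ∈ Set.Ioo (1/2 : ℝ) 1) (h₂ : H₂ ∈ Set.Ioo (1/2 : ℝ) 1)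
    (h₃ : H₃ ∈ Set.Ioo (1/2 : ℝ) 1)
    (hsum : 2 < H₁ + H₂ + H₃) (hκ : κ = H₁ + H₂ + H₃ - 2)
    (ht₀ : 0 < t₀) (ht₀T : t₀ ≤ T) :
    (∃ c₂ : ℝ, 0 < c₂ ∧ ∀ t tbar : ℝ, 0 ≤ t → t < tbar → tbar ≤ T →
        Ztwo H₁ H₂ H₃ t tbar ≤ ENNReal.ofReal (c₂ * (tbar - t) ^ (2 * κ))) ∧
    (∃ c₁ δ : ℝ, 0 < c₁ ∧ 0 < δ ∧ ∀ t tbar : ℝ, t₀ ≤ t → t < tbar → tbar ≤ T →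
        tbar - t ≤ δ →
        ENNReal.ofReal (c₁ * (tbar - t) ^ (2 * κ)) ≤ Ztwo H₁ H₂ H₃ t tbar) := by
  have hH : ∀ i, ![H₁, H₂, H₃] i ∈ Set.Ioo (1/2 : ℝ) 1 := by
    intro i; fin_cases i <;> assumption
  have hκ' : ∑ i, ![H₁, H₂, H₃] i = κ + 2 := by
    simp [Fin.sum_univ_three, hκ]
  have hκ0 : 0 < κ := by linarith
  have hT : 0 < T := ht₀.trans_le ht₀T
  constructor
  · obtain ⟨C, hC, hbound⟩ := lintegral_prod_mul_sin_sub_sin_sq_le hH hκ' hκ0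
    refine ⟨(C + 1) * T, by positivity, fun t tbar ht hlt hle => ?_⟩
    have hh : 0 < tbar - t := sub_pos.2 hlt
    calc Ztwo H₁ H₂ H₃ t tbar
        ≤ ∫⁻ _s in Set.Ioc (0 : ℝ) t, ENNReal.ofReal (C * (tbar - t) ^ (2 * κ)) := by
          refine lintegral_mono fun s => ?_
          simpa [Fin.prod_univ_three] using
            hbound (tbar - t) hh (tbar - s) (t - s) (by ring)
      _ = ENNReal.ofReal (C * (tbar - t) ^ (2 * κ) * t) := by
          rw [setLIntegral_const, Real.volume_Ioc, sub_zero, ← ENNReal.ofReal_mul (by positivity)]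
      _ ≤ _ := by
          refine ENNReal.ofReal_le_ofReal ?_
          rw [mul_right_comm]
          gcongr <;> linarith
  · refine ⟨t₀ / 1536, t₀ / 4, by positivity, by positivity, fun t tbar ht hlt _ hδ => ?_⟩
    simpa [Ztwo, Fin.prod_univ_three] using
      le_lintegral_lintegral_prod_mul_sin_sub_sin_sq hH hκ' ht₀ ht hlt hδ
end
end
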